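/- Let G^{A,B} be a biconed graph. Every 2-edge-rooted forest of G^{A,B}_red that is not of maximal degree is a proper sub-multiset of some other 2-edge-rooted forest of G^{A,B}_red. -/

import Mathlib

/-!
Formalization scaffold for "h-vectors of graphic matroids of biconed graphs".

A graph `G` (loops and parallel edges allowed) with vertex set `A ∪ B` is
modelled by an abstract finite edge type `E` with an endpoint map
`ends : E → Sym2 (Fin m ⊕ₗ Fin n)`, where `A = Fin m = {1,…,m}`,
`Ā = B \ A = Fin n = {1̄,…,n̄}` and the finset `S ⊆ Fin m` records `A ∩ B`
(so `B = S ∪ Ā`).  The biconing `G^{A,B}` adds the two vertices `0` and `0̄`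
and the edges `00̄`, `0a (a ∈ A)` and `0̄b (b ∈ B)`.
-/

namespace BiconedPaper

noncomputable section
open scoped Classical

/-! ### Walks in multigraphs presented by an endpoint map -/

/-- A walk in the multigraph with edge set `ε` and endpoint map `ends`. -/
inductive MWalk {ε ν : Type} (ends : ε → Sym2 ν) : ν → ν → Type
  | nil (u : ν) : MWalk ends u u
  | cons {u w : ν} (e : ε) (v : ν) (h : ends e = s(u, v)) (p : MWalk ends v w) :
      MWalk ends u w

namespace MWalk

variable {ε ν : Type} {ends : ε → Sym2 ν}

/-- The list of edges traversed by a walk. -/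
def edges : ∀ {u v : ν}, MWalk ends u v → List ε
  | _, _, nil _ => []
  | _, _, cons e _ _ p => e :: p.edges

/-- The list of vertices visited by a walk. -/
def support : ∀ {u v : ν}, MWalk ends u v → List ν
  | u, _, nil _ => [u]
  | u, _, cons _ _ _ p => u :: p.support

/-- A walk is a path if it visits no vertex twice. -/
def IsPath {u v : ν} (p : MWalk ends u v) : Prop := p.support.Nodup

/-- All edges of the walk belong to the edge set `F`. -/
def edgesIn {u v : ν} (p : MWalk ends u v) (F : Finset ε) : Prop :=
  ∀ e ∈ p.edges, e ∈ F

/-- The number of "bridging" edges traversed by a walk, i.e. steps whose two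
endpoints lie on different sides according to `sideF`. -/
def bridgeCount (sideF : ν → Bool) : ∀ {u v : ν}, MWalk ends u v → ℕ
  | _, _, nil _ => 0
  | u, _, cons _ v' _ p => (if sideF u = sideF v' then 0 else 1) + p.bridgeCount sideF

end MWalk

/-- `u` and `v` are joined by a walk all of whose edges lie in `F`. -/
def Reachable {ε ν : Type} (ends : ε → Sym2 ν) (F : Finset ε) (u v : ν) : Prop :=
  ∃ p : MWalk ends u v, p.edgesIn F

/-- An edge set is acyclic (a forest) iff removing any one of its edges
disconnects the endpoints of that edge.  (In particular no loops and no
parallel pairs.) -/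
def IsAcyclic {ε ν : Type} [DecidableEq ε] (ends : ε → Sym2 ν) (F : Finset ε) : Prop :=
  ∀ e ∈ F, ∀ u v : ν, ends e = s(u, v) → ¬ Reachable ends (F.erase e) u v

/-- A spanning tree: an acyclic edge set connecting every pair of vertices. -/
def IsSpanningTree {ε ν : Type} [DecidableEq ε] (ends : ε → Sym2 ν) (T : Finset ε) : Prop :=
  IsAcyclic ends T ∧ ∀ u v : ν, Reachable ends T u v

/-! ### Biconed graphs -/

/-- The data of a biconed graph `G^{A,B}`:  the graph `G` has vertex set
`A ∪ B` with `A = Fin m`, `Ā = B \ A = Fin n`, `A ∩ B = S`, and abstract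
edge set `E` (so loops and parallel edges are allowed). -/
structure BiconedGraph where
  m : ℕ
  n : ℕ
  E : Type
  fintypeE : Fintype E
  decEqE : DecidableEq E
  ends : E → Sym2 (Fin m ⊕ₗ Fin n)
  S : Finset (Fin m)

namespace BiconedGraph

variable (P : BiconedGraph)

instance : Fintype P.E := P.fintypeE
instance : DecidableEq P.E := P.decEqE

/-- The vertices of `G`, linearly ordered `1 < ⋯ < m < 1̄ < ⋯ < n̄`. -/
abbrev VG := Fin P.m ⊕ₗ Fin P.n

/-- The vertices of `G^{A,B}_red`:  `⊥` is the vertex `0̄`, ordered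
`0̄ < 1 < ⋯ < m < 1̄ < ⋯ < n̄`. -/
abbrev Vred := WithBot P.VG

/-- The vertices of `G^{A,B}`: `⊥` is `0`, ordered `0 < 0̄ < 1 < ⋯ < n̄`. -/
abbrev W := WithBot P.Vred

/-- The vertex `a ∈ A`. -/
def aVert (a : Fin P.m) : P.VG := toLex (Sum.inl a)
/-- The vertex `b ∈ Ā`. -/
def bVert (b : Fin P.n) : P.VG := toLex (Sum.inr b)
/-- Inclusion of the vertices of `G` into those of `G^{A,B}_red`. -/
def liftV (x : P.VG) : P.Vred := (x : WithBot P.VG)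
/-- Inclusion of the vertices of `G^{A,B}_red` into those of `G^{A,B}`. -/
def liftW (x : P.Vred) : P.W := (x : WithBot P.Vred)

/-- The edges of the biconed graph `G^{A,B}`:  the edge `00̄`, the coning
edges `0a (a ∈ A)`, `0̄b (b ∈ Ā)`, `0̄a (a ∈ A ∩ B)`, and the edges of `G`. -/
abbrev EB := Unit ⊕ (Fin P.m ⊕ (Fin P.n ⊕ ({a : Fin P.m // a ∈ P.S} ⊕ P.E)))

/-- The edge `00̄`. -/
abbrev e00 : P.EB := Sum.inl ()
/-- The coning edge `0a`, `a ∈ A`. -/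
abbrev eA (a : Fin P.m) : P.EB := Sum.inr (Sum.inl a)
/-- The coning edge `0̄b`, `b ∈ Ā`. -/
abbrev eB (b : Fin P.n) : P.EB := Sum.inr (Sum.inr (Sum.inl b))
/-- The coning edge `0̄a`, `a ∈ A ∩ B`. -/
abbrev eS (a : {a : Fin P.m // a ∈ P.S}) : P.EB := Sum.inr (Sum.inr (Sum.inr (Sum.inl a)))
/-- An original edge of `G`. -/
abbrev eG (e : P.E) : P.EB := Sum.inr (Sum.inr (Sum.inr (Sum.inr e)))

/-- The endpoint map of `G^{A,B}`. -/
def endsB : P.EB → Sym2 P.W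
  | Sum.inl _ => s((⊥ : P.W), P.liftW ⊥)
  | Sum.inr (Sum.inl a) => s((⊥ : P.W), P.liftW (P.liftV (P.aVert a)))
  | Sum.inr (Sum.inr (Sum.inl b)) => s(P.liftW ⊥, P.liftW (P.liftV (P.bVert b)))
  | Sum.inr (Sum.inr (Sum.inr (Sum.inl a))) => s(P.liftW ⊥, P.liftW (P.liftV (P.aVert a.1)))
  | Sum.inr (Sum.inr (Sum.inr (Sum.inr e))) => (P.ends e).map fun x => P.liftW (P.liftV x)

/-- The spanning tree `T₀`, consisting of `00̄`, the edges `0a (a ∈ A)` and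
the edges `0̄b (b ∈ Ā)`. -/
def T0 : Finset P.EB :=
  Finset.univ.filter fun e => match e with
    | Sum.inl _ => True
    | Sum.inr (Sum.inl _) => True
    | Sum.inr (Sum.inr (Sum.inl _)) => True
    | _ => False

/-- The edges of `G^{A,B}_red` (delete the edges of `T₀` and the vertex `0`):
the edges `0̄a (a ∈ A ∩ B)` together with the edges of `G`. -/
abbrev Ered := {a : Fin P.m // a ∈ P.S} ⊕ P.E

/-- The endpoint map of `G^{A,B}_red`; `⊥` is the vertex `0̄`. -/
def endsRed : P.Ered → Sym2 P.Vred
  | Sum.inl a => s((⊥ : P.Vred), P.liftV (P.aVert a.1))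
  | Sum.inr e => (P.ends e).map P.liftV

/-- Inclusion of the edges of `G^{A,B}_red` into those of `G^{A,B}`. -/
def redToEB : P.Ered → P.EB
  | Sum.inl a => P.eS a
  | Sum.inr e => P.eG e

/-- The edge set `T \ T₀` of `T`, viewed inside `G^{A,B}_red`. -/
def redOf (T : Finset P.EB) : Finset P.Ered :=
  Finset.univ.filter fun e => P.redToEB e ∈ T

/-- `true` on the vertices of `A`, `false` on the vertices of `Ā ∪ {0̄}`. -/
def side : P.Vred → Bool :=
  WithBot.recBotCoe false fun x => Sum.elim (fun _ => true) (fun _ => false) (ofLex x)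

/-- The vertex lies in `A`. -/
def InA (v : P.Vred) : Prop := ∃ a : Fin P.m, v = P.liftV (P.aVert a)

/-- An edge of `G^{A,B}_red` is bridging if it joins a vertex of `A` to a
vertex of `Ā ∪ {0̄}`. -/
def BridgingE (e : P.Ered) : Prop :=
  ∃ u v : P.Vred, P.endsRed e = s(u, v) ∧ P.side u ≠ P.side v

/-! ### 2-edge-rooted forests -/

/-- The underlying edge set `F` of the multiset of edges given by the
multiplicity function `mult` (an edge `e` carries `mult e - 1` edge roots). -/
def mSupport (mult : P.Ered → ℕ) : Finset P.Ered :=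
  Finset.univ.filter fun e => mult e ≠ 0

/-- The degree of the multiset of edges given by `mult`. -/
def deg (mult : P.Ered → ℕ) : ℕ := ∑ e : P.Ered, mult e

/-- Edge `e` meets the connected component of `v` in the edge set `F`. -/
def Touches (F : Finset P.Ered) (v : P.Vred) (e : P.Ered) : Prop :=
  ∃ u : P.Vred, u ∈ P.endsRed e ∧ Reachable P.endsRed F v u

/-- The total number of edge roots in the component of `v`. -/
def compEdgeRoots (mult : P.Ered → ℕ) (v : P.Vred) : ℕ :=
  ∑ e ∈ P.mSupport mult, if P.Touches (P.mSupport mult) v e then mult e - 1 else 0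

/-- The component of `v` is `compCount`-edge-rooted:  the number of its edge
roots, plus `1` if it contains the vertex `0̄`. -/
def compCount (mult : P.Ered → ℕ) (v : P.Vred) : ℕ :=
  P.compEdgeRoots mult v +
    if Reachable P.endsRed (P.mSupport mult) v (⊥ : P.Vred) then 1 else 0

/-- Condition (C3) for the `2`-edge-rooted component of `v`:  the unique
shortest path containing both edge roots (resp. the vertex `0̄` and the edge
root, if the component contains `0̄`) has an odd number of bridging edges.
The shortest path containing two edges is the unique path whose first and
last edges are the two rooted edges; if the two edge roots lie on one common
edge (`mult e = 3`) the path is that single edge. -/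
def C3At (mult : P.Ered → ℕ) (v : P.Vred) : Prop :=
  (Reachable P.endsRed (P.mSupport mult) v (⊥ : P.Vred) →
    ∃ (x : P.Vred) (p : MWalk P.endsRed (⊥ : P.Vred) x),
      p.IsPath ∧ p.edgesIn (P.mSupport mult) ∧
      (∃ e, p.edges.getLast? = some e ∧ 2 ≤ mult e) ∧
      Odd (p.bridgeCount P.side)) ∧
  (¬ Reachable P.endsRed (P.mSupport mult) v (⊥ : P.Vred) →
    ∃ (x y : P.Vred) (p : MWalk P.endsRed x y),
      p.IsPath ∧ p.edgesIn (P.mSupport mult) ∧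
      Reachable P.endsRed (P.mSupport mult) v x ∧
      (∃ e, p.edges.head? = some e ∧ 2 ≤ mult e) ∧
      (∃ e, p.edges.getLast? = some e ∧ 2 ≤ mult e) ∧
      (∀ e, p.edges = [e] → mult e = 3) ∧
      Odd (p.bridgeCount P.side))

/-- `mult : Ered → ℕ` is (the multiplicity function of) a 2-edge-rooted
forest of `G^{A,B}_red`:
(C0) its support is a spanning forest;
(C1) at most one component is `2`-edge-rooted;
(C2) every other component is `0`- or `1`-edge-rooted;
(C3) the parity condition on the path joining the two roots. -/
def Is2ERF (mult : P.Ered → ℕ) : Prop :=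
  IsAcyclic P.endsRed (P.mSupport mult) ∧
  (∀ v : P.Vred, P.compCount mult v ≤ 2) ∧
  (∀ u v : P.Vred, P.compCount mult u = 2 → P.compCount mult v = 2 →
    Reachable P.endsRed (P.mSupport mult) u v) ∧
  (∀ v : P.Vred, P.compCount mult v = 2 → P.C3At mult v)

/-! ### Birooted forests -/

/-- `(F, R)` is a birooted forest of `G^{A,B}_red`:  `F` is a spanning forest,
the root set `R` contains `0̄`, every component of `F` contains at least one
root, no component contains three roots, at most one component contains two
roots, and a component with two roots has one root in `A` and the other in
`Ā ∪ {0̄}`. -/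
def IsBirootedForest (F : Finset P.Ered) (R : Set P.Vred) : Prop :=
  IsAcyclic P.endsRed F ∧
  (⊥ : P.Vred) ∈ R ∧
  (∀ v : P.Vred, ∃ r ∈ R, Reachable P.endsRed F v r) ∧
  (∀ r₁ ∈ R, ∀ r₂ ∈ R, ∀ r₃ ∈ R, r₁ ≠ r₂ → r₁ ≠ r₃ → r₂ ≠ r₃ →
    Reachable P.endsRed F r₁ r₂ → Reachable P.endsRed F r₁ r₃ → False) ∧
  (∀ r₁ ∈ R, ∀ r₂ ∈ R, ∀ r₃ ∈ R, ∀ r₄ ∈ R, r₁ ≠ r₂ → r₃ ≠ r₄ →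
    Reachable P.endsRed F r₁ r₂ → Reachable P.endsRed F r₃ r₄ →
    Reachable P.endsRed F r₁ r₃) ∧
  (∀ r₁ ∈ R, ∀ r₂ ∈ R, r₁ ≠ r₂ → Reachable P.endsRed F r₁ r₂ →
    (P.InA r₁ ∧ ¬ P.InA r₂) ∨ (P.InA r₂ ∧ ¬ P.InA r₁))

/-! ### Internal activity and the edge order -/

/-- `e` is internally passive in the spanning tree `T`:  it can be exchanged
for a strictly smaller edge `f` so that the result is again a spanning tree. -/
def InternallyPassive (ord : LinearOrder P.EB) (T : Finset P.EB) (e : P.EB) : Prop :=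
  e ∈ T ∧ ∃ f : P.EB, ord.lt f e ∧ IsSpanningTree P.endsB (insert f (T.erase e))

/-- `e` is internally active in the spanning tree `T`. -/
def InternallyActive (ord : LinearOrder P.EB) (T : Finset P.EB) (e : P.EB) : Prop :=
  e ∈ T ∧ ¬ ∃ f : P.EB, ord.lt f e ∧ IsSpanningTree P.endsB (insert f (T.erase e))

/-- The number of internally passive edges of `T`. -/
def ipCount (ord : LinearOrder P.EB) (T : Finset P.EB) : ℕ :=
  (T.filter fun e => P.InternallyPassive ord T e).card

/-- The smaller endpoint of an edge of `G^{A,B}`. -/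
def endMin (e : P.EB) : P.W := Sym2.lift ⟨fun a b => a ⊓ b, fun a b => inf_comm a b⟩ (P.endsB e)
/-- The larger endpoint of an edge of `G^{A,B}`. -/
def endMax (e : P.EB) : P.W := Sym2.lift ⟨fun a b => a ⊔ b, fun a b => sup_comm a b⟩ (P.endsB e)

/-- The endpoints of an edge, as an ordered pair in the lexicographic square
of the vertex order `0 < 0̄ < 1 < ⋯ < m < 1̄ < ⋯ < n̄`. -/
def lexEnds (e : P.EB) : P.W ×ₗ P.W := toLex (P.endMin e, P.endMax e)

/-- A linear order on the edges of `G^{A,B}` is admissible if it refines the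
lexicographic order on endpoints (so parallel edges are ordered arbitrarily). -/
def AdmissibleOrder (ord : LinearOrder P.EB) : Prop :=
  ∀ e f : P.EB, P.lexEnds e < P.lexEnds f → ord.lt e f

/-- `v` is a connecting vertex of `T`:  `v ∈ A` and `v` is adjacent to `0` in
`T`, or `v ∈ Ā` and `v` is adjacent to `0̄` in `T`. -/
def ConnVertex (T : Finset P.EB) (v : P.Vred) : Prop :=
  (∃ a : Fin P.m, v = P.liftV (P.aVert a) ∧ P.eA a ∈ T) ∨
  (∃ b : Fin P.n, v = P.liftV (P.bVert b) ∧ P.eB b ∈ T)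

/-- `e` is a connecting edge of `T` (an edge `0a`, `a ∈ A`, or `0̄b`, `b ∈ Ā`)
with connecting vertex `v`. -/
def ConnEdge (T : Finset P.EB) (e : P.EB) (v : P.Vred) : Prop :=
  e ∈ T ∧ ((∃ a : Fin P.m, e = P.eA a ∧ v = P.liftV (P.aVert a)) ∨
           (∃ b : Fin P.n, e = P.eB b ∧ v = P.liftV (P.bVert b)))

/-! ### The h-vector -/

/-- `f_{i-1}`:  the number of acyclic edge sets of cardinality `i` in `G^{A,B}`. -/
def numAcyclic (i : ℕ) : ℕ :=
  Nat.card {F : Finset P.EB // IsAcyclic P.endsB F ∧ F.card = i}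

/-- The rank of the graphic matroid of `G^{A,B}`:  `|V| - 1 = m + n + 1`. -/
def d : ℕ := P.m + P.n + 1

/-- `h` is the h-vector of the graphic matroid of `G^{A,B}`:  it satisfies
`Σ_{i=0}^{d} f_{i-1} (t-1)^{d-i} = Σ_{k=0}^{d} h_k t^{d-k}`. -/
def IsHVector (h : ℕ → ℤ) : Prop :=
  ∑ i ∈ Finset.range (P.d + 1),
      Polynomial.C ((P.numAcyclic i : ℤ)) * (Polynomial.X - 1) ^ (P.d - i)
    = ∑ k ∈ Finset.range (P.d + 1), Polynomial.C (h k) * Polynomial.X ^ (P.d - k)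

end BiconedGraph

/-- `(h 0, …, h d)` is a pure O-sequence:  there is a multicomplex `M` of
multisets on a finite ground set (nonempty, closed under sub-multisets), all
of whose inclusion-maximal members have the same cardinality, whose members
all have cardinality at most `d`, and which has exactly `h i` members of
cardinality `i` for every `i ≤ d`. -/
def IsPureOSeq (d : ℕ) (h : ℕ → ℤ) : Prop :=
  ∃ (N : ℕ) (M : Set (Multiset (Fin N))),
    M.Nonempty ∧
    (∀ s ∈ M, ∀ t : Multiset (Fin N), t ≤ s → t ∈ M) ∧
    (∀ s ∈ M, ∀ t ∈ M, (∀ u ∈ M, s ≤ u → u = s) → (∀ u ∈ M, t ≤ u → u = t) →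
      Multiset.card s = Multiset.card t) ∧
    (∀ s ∈ M, Multiset.card s ≤ d) ∧
    (∀ i ≤ d, (Nat.card {s : Multiset (Fin N) // s ∈ M ∧ Multiset.card s = i} : ℤ) = h i)


/-! ### Auxiliary lemmas -/

namespace MWalk

variable {ε ν : Type} {ends : ε → Sym2 ν}

def append : ∀ {u v w : ν}, MWalk ends u v → MWalk ends v w → MWalk ends u w
  | _, _, _, nil _, q => q
  | _, _, _, cons e v h p, q => cons e v h (p.append q)

def reverse : ∀ {u v : ν}, MWalk ends u v → MWalk ends v u
  | _, _, nil u => nil u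
  | u, _, cons e _ h p => p.reverse.append (cons e u (by rw [h, Sym2.eq_swap]) (nil u))

lemma edges_append {u v w : ν} (p : MWalk ends u v) (q : MWalk ends v w) :
    (p.append q).edges = p.edges ++ q.edges := by
  induction p with
  | nil u => rfl
  | cons e v h p ih => simp [append, edges, ih]

lemma support_ne_nil {u v : ν} (p : MWalk ends u v) : p.support ≠ [] := by
  cases p <;> simp [support]

lemma support_eq_cons {u v : ν} (p : MWalk ends u v) : p.support = u :: p.support.tail := by
  cases p <;> simp [support]

lemma start_mem {u v : ν} (p : MWalk ends u v) : u ∈ p.support := by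
  rw [support_eq_cons]; simp

lemma support_append {u v w : ν} (p : MWalk ends u v) (q : MWalk ends v w) :
    (p.append q).support = p.support ++ q.support.tail := by
  induction p with
  | nil u => simp only [append, support]; rw [support_eq_cons]; simp
  | cons e v h p ih => simp [append, support, ih]

lemma support_append_cons {u v w z : ν} (p : MWalk ends u v) (e : ε) (h : ends e = s(v, w))
    (q : MWalk ends w z) :
    (p.append (cons e w h q)).support = p.support ++ q.support := by
  rw [support_append]; rfl

lemma edges_reverse {u v : ν} (p : MWalk ends u v) : p.reverse.edges = p.edges.reverse := by
  induction p with
  | nil u => rfl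
  | cons e v h p ih => simp [reverse, edges, edges_append, ih]

lemma support_reverse {u v : ν} (p : MWalk ends u v) :
    p.reverse.support = p.support.reverse := by
  induction p with
  | nil u => rfl
  | cons e v h p ih => simp [reverse, support, support_append, ih]

lemma IsPath.reverse {u v : ν} {p : MWalk ends u v} (hp : p.IsPath) : p.reverse.IsPath := by
  unfold IsPath at *
  rw [support_reverse]; exact List.nodup_reverse.2 hp

lemma edgesIn.reverse {u v : ν} {p : MWalk ends u v} {F : Finset ε} (hp : p.edgesIn F) :
    p.reverse.edgesIn F := by
  intro e he
  rw [edges_reverse] at he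
  exact hp e (by simpa using he)

lemma edgesIn.append {u v w : ν} {p : MWalk ends u v} {q : MWalk ends v w} {F : Finset ε}
    (hp : p.edgesIn F) (hq : q.edgesIn F) : (p.append q).edgesIn F := by
  intro e he
  rw [edges_append, List.mem_append] at he
  exact he.elim (hp e) (hq e)

lemma edgesIn.mono {u v : ν} {p : MWalk ends u v} {F F' : Finset ε}
    (hp : p.edgesIn F) (h : F ⊆ F') : p.edgesIn F' := fun e he => h (hp e he)

/-- drop the walk until a vertex of its support -/
lemma exists_drop {u v x : ν} (p : MWalk ends u v) (hx : x ∈ p.support) :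
    ∃ q : MWalk ends x v, q.support <:+ p.support ∧ q.edges <:+ p.edges := by
  induction p with
  | nil u =>
    simp only [support, List.mem_singleton] at hx
    subst hx
    exact ⟨nil _, List.suffix_refl _, List.suffix_refl _⟩
  | @cons u w e v h p ih =>
    by_cases hxu : x = u
    · subst hxu
      exact ⟨cons e v h p, List.suffix_refl _, List.suffix_refl _⟩
    · have : x ∈ p.support := by
        simp only [support, List.mem_cons] at hx
        exact hx.resolve_left hxu
      obtain ⟨q, h1, h2⟩ := ih this
      exact ⟨q, h1.trans (List.suffix_cons _ _), h2.trans (List.suffix_cons _ _)⟩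

lemma exists_path {u v : ν} (p : MWalk ends u v) (F : Finset ε) (hp : p.edgesIn F) :
    ∃ q : MWalk ends u v, q.IsPath ∧ q.edgesIn F := by
  induction p with
  | nil u => exact ⟨nil u, by simp [IsPath, support], hp⟩
  | @cons u w e v h p ih =>
    obtain ⟨q, hq, hqF⟩ := ih (fun f hf => hp f (by simp [edges, hf]))
    by_cases hu : u ∈ q.support
    · obtain ⟨r, hr1, hr2⟩ := q.exists_drop hu
      exact ⟨r, List.Nodup.sublist hr1.sublist hq, fun f hf => hqF f (hr2.subset hf)⟩
    · refine ⟨cons e v h q, ?_, ?_⟩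
      · simp only [IsPath, support, List.nodup_cons]; exact ⟨hu, hq⟩
      · intro f hf
        simp only [edges, List.mem_cons] at hf
        rcases hf with rfl | hf
        · exact hp _ (by simp [edges])
        · exact hqF f hf

lemma odd_bridge (sideF : ν → Bool) {u v : ν} (p : MWalk ends u v) :
    Odd (p.bridgeCount sideF) ↔ sideF u ≠ sideF v := by
  induction p with
  | nil u => simp [bridgeCount]
  | @cons u w e v h p ih =>
    simp only [bridgeCount]
    by_cases h1 : sideF u = sideF v
    · rw [if_pos h1, zero_add, ih, h1]
    · rw [if_neg h1, add_comm, Nat.odd_add_one, ih]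
      revert h1
      cases sideF u <;> cases sideF v <;> cases sideF w <;> simp

lemma bridge_side (sideF : ν → Bool) {u v : ν} (p : MWalk ends u v) (F : Finset ε)
    (hp : p.edgesIn F)
    (hF : ∀ e ∈ F, ∀ a b, ends e = s(a, b) → sideF a = sideF b) : sideF u = sideF v := by
  induction p with
  | nil u => rfl
  | @cons u w e v h p ih =>
    rw [hF e (hp e (by simp [edges])) _ _ h]
    exact ih (fun f hf => hp f (by simp [edges, hf]))

end MWalk

section generic

variable {ε ν : Type} {ends : ε → Sym2 ν}

lemma Reachable.refl (F : Finset ε) (u : ν) : Reachable ends F u u :=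
  ⟨MWalk.nil u, by intro e he; simp [MWalk.edges] at he⟩

lemma Reachable.symm {F : Finset ε} {u v : ν} (h : Reachable ends F u v) :
    Reachable ends F v u := by
  obtain ⟨p, hp⟩ := h
  exact ⟨p.reverse, hp.reverse⟩

lemma Reachable.trans {F : Finset ε} {u v w : ν} (h : Reachable ends F u v)
    (h' : Reachable ends F v w) : Reachable ends F u w := by
  obtain ⟨p, hp⟩ := h
  obtain ⟨q, hq⟩ := h'
  exact ⟨p.append q, hp.append hq⟩

lemma Reachable.mono {F F' : Finset ε} {u v : ν} (h : Reachable ends F u v) (hF : F ⊆ F') :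
    Reachable ends F' u v := by
  obtain ⟨p, hp⟩ := h
  exact ⟨p, hp.mono hF⟩

lemma Reachable.edge {F : Finset ε} {u v : ν} {e : ε} (he : e ∈ F) (h : ends e = s(u, v)) :
    Reachable ends F u v :=
  ⟨MWalk.cons e v h (MWalk.nil v), by
    intro f hf; simp only [MWalk.edges, List.mem_singleton] at hf; rwa [hf]⟩

lemma reach_insert {F F' : Finset ε} {e : ε} {u v : ν} (hF : ∀ f ∈ F', f ∈ F ∨ f = e)
    (he : ends e = s(u, v)) {x y : ν} (h : Reachable ends F' x y) :
    Reachable ends F x y ∨ (Reachable ends F x u ∧ Reachable ends F v y) ∨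
      (Reachable ends F x v ∧ Reachable ends F u y) := by
  obtain ⟨p, hp⟩ := h
  induction p with
  | nil x => exact Or.inl (Reachable.refl _ _)
  | @cons x y f w hf p ih =>
    have ih := ih (fun f hf => hp f (by simp [MWalk.edges, hf]))
    rcases hF f (hp f (by simp [MWalk.edges])) with h1 | h1
    · have hxw : Reachable ends F x w := Reachable.edge h1 hf
      rcases ih with h | ⟨h, h'⟩ | ⟨h, h'⟩
      · exact Or.inl (hxw.trans h)
      · exact Or.inr (Or.inl ⟨hxw.trans h, h'⟩)
      · exact Or.inr (Or.inr ⟨hxw.trans h, h'⟩)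
    · subst h1
      rw [he, Sym2.eq_iff] at hf
      rcases hf with ⟨rfl, rfl⟩ | ⟨rfl, rfl⟩
      · rcases ih with h | ⟨h, h'⟩ | ⟨h, h'⟩
        · exact Or.inr (Or.inl ⟨Reachable.refl _ _, h⟩)
        · exact Or.inl (h.symm.trans h')
        · exact Or.inl h'
      · rcases ih with h | ⟨h, h'⟩ | ⟨h, h'⟩
        · exact Or.inr (Or.inr ⟨Reachable.refl _ _, h⟩)
        · exact Or.inl h'
        · exact Or.inl (h.symm.trans h')

lemma IsAcyclic.mono [DecidableEq ε] {F F' : Finset ε} (h : IsAcyclic ends F') (hF : F ⊆ F') :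
    IsAcyclic ends F := fun e he u v huv hr =>
  h e (hF he) u v huv (hr.mono (Finset.erase_subset_erase e hF))

lemma IsAcyclic.insert [DecidableEq ε] {F : Finset ε} (h : IsAcyclic ends F) {e : ε} {u v : ν}
    (he : ends e = s(u, v)) (huv : ¬ Reachable ends F u v) :
    IsAcyclic ends (insert e F) := by
  intro f hf a b hab hr
  by_cases hfe : f = e
  · subst hfe
    have hr : Reachable ends F a b := hr.mono (by
      intro g hg; simp only [Finset.mem_erase, Finset.mem_insert] at hg; tauto)
    rw [he, Sym2.eq_iff] at hab
    rcases hab with ⟨rfl, rfl⟩ | ⟨rfl, rfl⟩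
    · exact huv hr
    · exact huv hr.symm
  · have hfF : f ∈ F := by
      simp only [Finset.mem_insert] at hf; tauto
    have hsub : F.erase f ⊆ F := Finset.erase_subset _ _
    have hab' : Reachable ends F a b := Reachable.edge hfF hab
    rcases reach_insert (F := F.erase f) (e := e) (by
      intro g hg
      simp only [Finset.mem_erase, Finset.mem_insert] at hg ⊢; tauto) he hr with h1 | ⟨h1, h2⟩ | ⟨h1, h2⟩
    · exact h f hfF a b hab h1
    · exact huv ((h1.mono hsub).symm.trans (hab'.trans (h2.mono hsub).symm))
    · exact huv ((h2.mono hsub).trans (hab'.symm.trans (h1.mono hsub)))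

lemma exists_rep [DecidableEq ε] [DecidableEq ν] [Fintype ν] (F : Finset ε) (hF : IsAcyclic ends F) :
    ∃ rep : ν → ν, (∀ u v, rep u = rep v ↔ Reachable ends F u v) ∧
      (∀ v, rep (rep v) = rep v) ∧
      (Finset.univ.image rep).card + F.card = Fintype.card ν := by
  induction F using Finset.induction_on with
  | empty =>
    refine ⟨id, ?_, fun _ => rfl, by simp⟩
    intro u v
    constructor
    · rintro h; simp only [id] at h; subst h; exact Reachable.refl _ _
    · rintro ⟨p, hp⟩
      cases p with
      | nil => rfl
      | cons e v h p => exact absurd (hp e (by simp [MWalk.edges])) (by simp)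
  | insert e F he ih =>
    obtain ⟨rep, h1, h2, h3⟩ := ih (hF.mono (Finset.subset_insert e F))
    obtain ⟨u, v, huv⟩ : ∃ u v, ends e = s(u, v) := by
      induction h : ends e using Sym2.ind with
      | _ u v => exact ⟨u, v, rfl⟩
    have hnr : ¬ Reachable ends F u v := by
      have := hF e (by simp) u v huv
      rwa [Finset.erase_insert he] at this
    have hne : rep u ≠ rep v := fun h => hnr ((h1 u v).1 h)
    have hsub : F ⊆ Insert.insert e F := Finset.subset_insert e F
    have huv' : Reachable ends (Insert.insert e F) u v := Reachable.edge (by simp) huv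
    refine ⟨fun x => if rep x = rep u then rep v else rep x, ?_, ?_, ?_⟩
    · intro x y
      constructor
      · intro h
        dsimp only at h
        split_ifs at h with hx hy hy
        · exact ((h1 _ _).1 (hx.trans hy.symm)).mono hsub
        · exact (((h1 _ _).1 hx).mono hsub).trans (huv'.trans (((h1 _ _).1 h).mono hsub))
        · exact (((h1 _ _).1 h).mono hsub).trans (huv'.symm.trans (((h1 _ _).1 hy.symm).mono hsub))
        · exact ((h1 _ _).1 h).mono hsub
      · intro h
        dsimp only
        rcases reach_insert (F := F) (e := e) (by
          intro g hg; simp only [Finset.mem_insert] at hg; tauto) huv h with h | ⟨h, h'⟩ | ⟨h, h'⟩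
        · rw [(h1 _ _).2 h]
        · have ha := (h1 _ _).2 h
          have hb := (h1 _ _).2 h'
          rw [if_pos ha, ← hb, if_neg hne.symm]
        · have ha := (h1 _ _).2 h
          have hb := (h1 _ _).2 h'
          rw [ha, ← hb, if_pos rfl, if_neg hne.symm]
    · intro x
      dsimp only
      by_cases hx : rep x = rep u
      · rw [if_pos hx, h2, if_neg hne.symm]
      · rw [if_neg hx, h2, if_neg hx]
    · have himg : (Finset.univ.image fun x => if rep x = rep u then rep v else rep x)
          = (Finset.univ.image rep).erase (rep u) := by
        ext y
        simp only [Finset.mem_image, Finset.mem_univ, true_and, Finset.mem_erase]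
        constructor
        · rintro ⟨x, rfl⟩
          split_ifs with hx
          · exact ⟨hne.symm, v, rfl⟩
          · exact ⟨hx, x, rfl⟩
        · rintro ⟨hy, x, rfl⟩
          exact ⟨x, by rw [if_neg hy]⟩
      have hmem : rep u ∈ Finset.univ.image rep := by simp
      have hpos : 0 < (Finset.univ.image rep).card := Finset.card_pos.2 ⟨_, hmem⟩
      rw [himg, Finset.card_erase_of_mem hmem, Finset.card_insert_of_notMem he]
      omega

/-- A path starting with a given edge of the component. -/
lemma exists_path_head {F : Finset ε} {r : ε} (hr : r ∈ F) {x y z : ν} (hxy : ends r = s(x, y))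
    (hne : x ≠ y) (hz : Reachable ends F x z) :
    ∃ (a : ν) (p : MWalk ends a z), (a = x ∨ a = y) ∧ p.IsPath ∧ p.edgesIn F ∧
      p.edges.head? = some r := by
  obtain ⟨p0, hp0⟩ := (Reachable.edge hr hxy).symm.trans hz
  obtain ⟨p, hp, hpF⟩ := p0.exists_path F hp0
  by_cases hx : x ∈ p.support
  · obtain ⟨q, hq1, hq2⟩ := p.exists_drop hx
    have hy : y ∉ q.support := by
      intro hy
      have hq1' := hq1
      have : q.support ≠ p.support := by
        intro h
        rw [q.support_eq_cons, p.support_eq_cons] at h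
        exact hne (List.cons.inj h).1
      rw [p.support_eq_cons, List.suffix_cons_iff] at hq1
      rw [← p.support_eq_cons] at hq1
      have h2 := hq1.resolve_left this
      have hp' : p.support.Nodup := hp
      rw [p.support_eq_cons, List.nodup_cons] at hp'
      exact hp'.1 (h2.subset hy)
    refine ⟨y, MWalk.cons r x (by rw [hxy, Sym2.eq_swap]) q, Or.inr rfl, ?_, ?_, rfl⟩
    · simp only [MWalk.IsPath, MWalk.support, List.nodup_cons]
      exact ⟨hy, List.Nodup.sublist hq1.sublist hp⟩
    · intro f hf
      simp only [MWalk.edges, List.mem_cons] at hf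
      rcases hf with rfl | hf
      · exact hr
      · exact hpF f (hq2.subset hf)
  · refine ⟨x, MWalk.cons r y hxy p, Or.inl rfl, ?_, ?_, rfl⟩
    · simp only [MWalk.IsPath, MWalk.support, List.nodup_cons]
      exact ⟨hx, hp⟩
    · intro f hf
      simp only [MWalk.edges, List.mem_cons] at hf
      rcases hf with rfl | hf
      · exact hr
      · exact hpF f hf

lemma MWalk.reach_of_mem {F : Finset ε} {u v x : ν} (p : MWalk ends u v) (hp : p.edgesIn F)
    (hx : x ∈ p.support) : Reachable ends F x v := by
  obtain ⟨q, _, hq⟩ := p.exists_drop hx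
  exact ⟨q, fun f hf => hp f (hq.subset hf)⟩

lemma exists_ends (ends : ε → Sym2 ν) (e : ε) : ∃ u v, ends e = s(u, v) := by
  induction h : ends e using Sym2.ind with
  | _ u v => exact ⟨u, v, rfl⟩

end generic

namespace BiconedGraph

variable (P : BiconedGraph)

lemma mem_mSupport {mult : P.Ered → ℕ} {e : P.Ered} : e ∈ P.mSupport mult ↔ mult e ≠ 0 := by
  simp [mSupport]

lemma touches_iff {F : Finset P.Ered} {e : P.Ered} (he : e ∈ F) {a b : P.Vred}
    (hab : P.endsRed e = s(a, b)) (x : P.Vred) :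
    P.Touches F x e ↔ Reachable P.endsRed F x a := by
  constructor
  · rintro ⟨u, hu, hr⟩
    rw [hab, Sym2.mem_iff] at hu
    rcases hu with rfl | rfl
    · exact hr
    · exact hr.trans (Reachable.edge he hab).symm
  · intro h
    exact ⟨a, by rw [hab]; simp, h⟩

lemma touches_congr {F : Finset P.Ered} {x y : P.Vred} (h : Reachable P.endsRed F x y)
    (e : P.Ered) : P.Touches F x e ↔ P.Touches F y e :=
  ⟨fun ⟨u, hu, hr⟩ => ⟨u, hu, h.symm.trans hr⟩, fun ⟨u, hu, hr⟩ => ⟨u, hu, h.trans hr⟩⟩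

lemma compCount_congr {mult : P.Ered → ℕ} {x y : P.Vred}
    (h : Reachable P.endsRed (P.mSupport mult) x y) :
    P.compCount mult x = P.compCount mult y := by
  have h2 : Reachable P.endsRed (P.mSupport mult) x ⊥ ↔
      Reachable P.endsRed (P.mSupport mult) y ⊥ := ⟨fun h' => h.symm.trans h', fun h' => h.trans h'⟩
  unfold compCount compEdgeRoots
  simp only [P.touches_congr h, h2]

lemma deg_formula (mult : P.Ered → ℕ) (rep : P.Vred → P.Vred)
    (h1 : ∀ u v, rep u = rep v ↔ Reachable P.endsRed (P.mSupport mult) u v)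
    (h2 : ∀ v, rep (rep v) = rep v)
    (h3 : (Finset.univ.image rep).card + (P.mSupport mult).card = Fintype.card P.Vred) :
    P.deg mult + 1 + (Finset.univ.image rep).card
      = Fintype.card P.Vred + ∑ r ∈ Finset.univ.image rep, P.compCount mult r := by
  have hrep : ∀ r ∈ Finset.univ.image rep, ∀ u,
      Reachable P.endsRed (P.mSupport mult) r u ↔ r = rep u := by
    intro r hr u
    obtain ⟨x, -, rfl⟩ := Finset.mem_image.1 hr
    rw [← h1, h2]
  have hdeg : P.deg mult = (P.mSupport mult).card + ∑ e ∈ P.mSupport mult, (mult e - 1) := by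
    unfold deg
    have : ∑ e, mult e = ∑ e ∈ P.mSupport mult, mult e := by
      symm
      apply Finset.sum_subset (Finset.subset_univ _)
      intro e _ he
      by_contra h
      exact he (P.mem_mSupport.2 h)
    rw [this, Finset.card_eq_sum_ones, ← Finset.sum_add_distrib]
    apply Finset.sum_congr rfl
    intro e he
    have := P.mem_mSupport.1 he
    omega
  have hsum : ∑ r ∈ Finset.univ.image rep, P.compCount mult r
      = ∑ e ∈ P.mSupport mult, (mult e - 1) + 1 := by
    unfold compCount compEdgeRoots
    rw [Finset.sum_add_distrib, Finset.sum_comm]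
    congr 1
    · apply Finset.sum_congr rfl
      intro e he
      obtain ⟨a, b, hab⟩ := exists_ends P.endsRed e
      have : ∀ r ∈ Finset.univ.image rep,
          (if P.Touches (P.mSupport mult) r e then mult e - 1 else 0)
            = if r = rep a then mult e - 1 else 0 := by
        intro r hr
        simp only [P.touches_iff he hab, hrep r hr]
      rw [Finset.sum_congr rfl this, Finset.sum_ite_eq', if_pos (by simp)]
    · have : ∀ r ∈ Finset.univ.image rep,
          (if Reachable P.endsRed (P.mSupport mult) r ⊥ then 1 else 0)
            = if r = rep ⊥ then 1 else 0 := by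
        intro r hr
        simp only [hrep r hr]
      rw [Finset.sum_congr rfl this, Finset.sum_ite_eq', if_pos (by simp)]
  rw [hdeg, hsum]
  omega

/-- isolated vertices (up to loops) different from `⊥`. -/
def isoSet : Finset P.Vred :=
  Finset.univ.filter fun v => v ≠ ⊥ ∧ ∀ e w, P.endsRed e = s(v, w) → v = w

lemma mem_isoSet {v : P.Vred} :
    v ∈ P.isoSet ↔ v ≠ ⊥ ∧ ∀ e w, P.endsRed e = s(v, w) → v = w := by
  simp [isoSet]

lemma acyclic_ne {F : Finset P.Ered} (hF : IsAcyclic P.endsRed F) {e : P.Ered} (he : e ∈ F)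
    {u v : P.Vred} (h : P.endsRed e = s(u, v)) : u ≠ v := by
  rintro rfl
  exact hF e he u u h (Reachable.refl _ _)

/-- A vertex all of whose edges in `F` are absent only reaches itself. -/
lemma eq_of_reach {F : Finset P.Ered} {v w : P.Vred}
    (hv : ∀ e ∈ F, ∀ w, P.endsRed e = s(v, w) → v = w)
    (h : Reachable P.endsRed F v w) : w = v := by
  obtain ⟨p, hp⟩ := h
  induction p with
  | nil => rfl
  | @cons u w e x h p ih =>
    have := hv e (hp e (by simp [MWalk.edges])) x h
    subst this
    exact ih hv (fun f hf => hp f (by simp [MWalk.edges, hf]))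

/-- count zero for a vertex without edges -/
lemma count_zero {mult : P.Ered → ℕ} (hF : IsAcyclic P.endsRed (P.mSupport mult))
    {v : P.Vred} (hb : v ≠ ⊥)
    (hv : ∀ e ∈ P.mSupport mult, ∀ w, P.endsRed e = s(v, w) → v = w) :
    P.compCount mult v = 0 := by
  unfold compCount compEdgeRoots
  rw [if_neg (fun h => hb (P.eq_of_reach hv h).symm), add_zero]
  apply Finset.sum_eq_zero
  intro e he
  rw [if_neg]
  intro ht
  obtain ⟨a, b, hab⟩ := exists_ends P.endsRed e
  rw [P.touches_iff he hab] at ht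
  have := P.eq_of_reach hv ht
  subst this
  exact P.acyclic_ne hF he hab (hv e he b hab)

/-- existence of a root in a component of count one (not containing ⊥) -/
lemma exists_root {mult : P.Ered → ℕ} {v : P.Vred} (hv : P.compCount mult v = 1)
    (hb : ¬ Reachable P.endsRed (P.mSupport mult) v ⊥) :
    ∃ r ∈ P.mSupport mult, P.Touches (P.mSupport mult) v r ∧ mult r = 2 := by
  unfold compCount at hv
  rw [if_neg hb, add_zero] at hv
  have hne : P.compEdgeRoots mult v ≠ 0 := by omega
  unfold compEdgeRoots at hne hv
  obtain ⟨r, hr, hr2⟩ := Finset.exists_ne_zero_of_sum_ne_zero hne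
  have hle := Finset.single_le_sum
    (f := fun e => if P.Touches (P.mSupport mult) v e then mult e - 1 else 0)
    (fun _ _ => Nat.zero_le _) hr
  rw [hv] at hle
  split_ifs at hr2 hle with ht
  · exact ⟨r, hr, ht, by omega⟩
  · exact absurd rfl hr2

lemma C3_mono {mult mult' : P.Ered → ℕ}
    (hm : ∀ e, 2 ≤ mult e → mult' e = mult e)
    (hF : P.mSupport mult ⊆ P.mSupport mult') {x y : P.Vred}
    (hxy : Reachable P.endsRed (P.mSupport mult') x y)
    (hy : Reachable P.endsRed (P.mSupport mult') y ⊥ → Reachable P.endsRed (P.mSupport mult) y ⊥)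
    (h : P.C3At mult y) : P.C3At mult' x := by
  constructor
  · intro hx
    obtain ⟨z, p, h1, h2, ⟨e, h3, h4⟩, h5⟩ := h.1 (hy (hxy.symm.trans hx))
    exact ⟨z, p, h1, h2.mono hF, ⟨e, h3, by rw [hm e h4]; exact h4⟩, h5⟩
  · intro hx
    obtain ⟨a, b, p, h1, h2, hya, ⟨e, h3, h4⟩, ⟨e', h3', h4'⟩, h6, h5⟩ :=
      h.2 (fun h => hx (hxy.trans (h.mono hF)))
    refine ⟨a, b, p, h1, h2.mono hF, hxy.trans (hya.mono hF),
      ⟨e, h3, by rw [hm e h4]; exact h4⟩, ⟨e', h3', by rw [hm e' h4']; exact h4'⟩, ?_, h5⟩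
    intro f hf
    have := h6 f hf
    rw [hm f (by omega), this]

/-! #### Raising the multiplicity of an edge -/

lemma support_raise {mult : P.Ered → ℕ} {e : P.Ered} (he : e ∈ P.mSupport mult) :
    P.mSupport (Function.update mult e (mult e + 1)) = P.mSupport mult := by
  ext f
  rw [mem_mSupport, mem_mSupport]
  by_cases hf : f = e
  · subst hf
    rw [mem_mSupport] at he
    simp [he]
  · simp [hf]

lemma count_raise {mult : P.Ered → ℕ} {e : P.Ered} (he : e ∈ P.mSupport mult) (x : P.Vred) :
    P.compCount (Function.update mult e (mult e + 1)) x = P.compCount mult x +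
      if P.Touches (P.mSupport mult) x e then 1 else 0 := by
  unfold compCount compEdgeRoots
  rw [P.support_raise he]
  have : ∀ f ∈ P.mSupport mult,
      (if P.Touches (P.mSupport mult) x f then
        Function.update mult e (mult e + 1) f - 1 else 0)
      = (if P.Touches (P.mSupport mult) x f then mult f - 1 else 0) +
        (if f = e then (if P.Touches (P.mSupport mult) x e then 1 else 0) else 0) := by
    intro f hf
    rw [mem_mSupport] at hf
    by_cases hfe : f = e
    · subst hfe
      simp only [Function.update_self, if_true]
      split_ifs <;> omega
    · simp [hfe]
  rw [Finset.sum_congr rfl this, Finset.sum_add_distrib, Finset.sum_ite_eq', if_pos he]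
  omega

/-! #### Adding an edge -/

lemma support_add {mult : P.Ered → ℕ} {e : P.Ered} :
    P.mSupport (Function.update mult e 1) = insert e (P.mSupport mult) := by
  ext f
  rw [mem_mSupport, Finset.mem_insert, mem_mSupport]
  by_cases hf : f = e
  · subst hf; simp
  · simp [hf]

lemma reach_add {F : Finset P.Ered} {e : P.Ered} {u v : P.Vred}
    (huv : P.endsRed e = s(u, v)) {x y : P.Vred} :
    Reachable P.endsRed (insert e F) x y ↔ (Reachable P.endsRed F x y ∨
      (Reachable P.endsRed F x u ∧ Reachable P.endsRed F v y) ∨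
      (Reachable P.endsRed F x v ∧ Reachable P.endsRed F u y)) := by
  have hsub : F ⊆ insert e F := Finset.subset_insert _ _
  have hu : Reachable P.endsRed (insert e F) u v := Reachable.edge (by simp) huv
  constructor
  · exact reach_insert (by intro f hf; rw [Finset.mem_insert] at hf; tauto) huv
  · rintro (h | ⟨h, h'⟩ | ⟨h, h'⟩)
    · exact h.mono hsub
    · exact (h.mono hsub).trans (hu.trans (h'.mono hsub))
    · exact (h.mono hsub).trans (hu.symm.trans (h'.mono hsub))

lemma count_add_far {mult : P.Ered → ℕ} {e : P.Ered} (he : mult e = 0) {u v : P.Vred}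
    (huv : P.endsRed e = s(u, v)) {x : P.Vred}
    (hxu : ¬ Reachable P.endsRed (P.mSupport mult) x u)
    (hxv : ¬ Reachable P.endsRed (P.mSupport mult) x v) :
    P.compCount (Function.update mult e 1) x = P.compCount mult x := by
  unfold compCount compEdgeRoots
  rw [P.support_add]
  have hr : ∀ y, Reachable P.endsRed (insert e (P.mSupport mult)) x y ↔
      Reachable P.endsRed (P.mSupport mult) x y := by
    intro y; rw [P.reach_add huv]; tauto
  have heF : e ∉ P.mSupport mult := by rw [mem_mSupport]; simpa using he
  rw [Finset.sum_insert heF]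
  simp only [hr, Function.update_self, Nat.sub_self, ite_self, zero_add]
  congr 1
  apply Finset.sum_congr rfl
  intro f hf
  obtain ⟨a, b, hab⟩ := exists_ends P.endsRed f
  have hfe : f ≠ e := fun h => heF (h ▸ hf)
  simp only [P.touches_iff hf hab, P.touches_iff (Finset.mem_insert_of_mem hf) hab, hr,
    Function.update_of_ne hfe]

lemma count_add_near {mult : P.Ered → ℕ} {e : P.Ered} (he : mult e = 0) {u v : P.Vred}
    (huv : P.endsRed e = s(u, v)) (hnr : ¬ Reachable P.endsRed (P.mSupport mult) u v)
    {x : P.Vred} (hx : Reachable P.endsRed (insert e (P.mSupport mult)) x u) :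
    P.compCount (Function.update mult e 1) x = P.compCount mult u + P.compCount mult v := by
  unfold compCount compEdgeRoots
  rw [P.support_add]
  have hr : ∀ y, Reachable P.endsRed (insert e (P.mSupport mult)) x y ↔
      (Reachable P.endsRed (P.mSupport mult) u y ∨ Reachable P.endsRed (P.mSupport mult) v y) := by
    intro y
    have h1 : Reachable P.endsRed (insert e (P.mSupport mult)) x y ↔
        Reachable P.endsRed (insert e (P.mSupport mult)) u y :=
      ⟨fun h => hx.symm.trans h, fun h => hx.trans h⟩
    rw [h1, P.reach_add huv]
    have := Reachable.refl (ends := P.endsRed) (P.mSupport mult) u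
    tauto
  have hex : ∀ y, ¬ (Reachable P.endsRed (P.mSupport mult) u y ∧
      Reachable P.endsRed (P.mSupport mult) v y) := fun y h => hnr (h.1.trans h.2.symm)
  have heF : e ∉ P.mSupport mult := by rw [mem_mSupport]; simpa using he
  have hadd : ∀ (y : P.Vred) (n : ℕ),
      (if Reachable P.endsRed (P.mSupport mult) u y ∨ Reachable P.endsRed (P.mSupport mult) v y
        then n else 0) = (if Reachable P.endsRed (P.mSupport mult) u y then n else 0) +
        (if Reachable P.endsRed (P.mSupport mult) v y then n else 0) := by
    intro y n
    have := hex y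
    by_cases h1 : Reachable P.endsRed (P.mSupport mult) u y <;>
      by_cases h2 : Reachable P.endsRed (P.mSupport mult) v y <;> simp_all
  rw [Finset.sum_insert heF]
  simp only [hr, hadd, Function.update_self, Nat.sub_self, ite_self, zero_add]
  have hs : ∀ f ∈ P.mSupport mult,
      (if P.Touches (insert e (P.mSupport mult)) x f then Function.update mult e 1 f - 1 else 0)
      = (if P.Touches (P.mSupport mult) u f then mult f - 1 else 0) +
        (if P.Touches (P.mSupport mult) v f then mult f - 1 else 0) := by
    intro f hf
    obtain ⟨a, b, hab⟩ := exists_ends P.endsRed f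
    have hfe : f ≠ e := fun h => heF (h ▸ hf)
    simp only [P.touches_iff hf hab, P.touches_iff (Finset.mem_insert_of_mem hf) hab, hr,
      Function.update_of_ne hfe, hadd]
  rw [Finset.sum_congr rfl hs, Finset.sum_add_distrib]
  omega

/-! #### The extension steps -/

lemma ext_isolated {mult : P.Ered → ℕ} (hm : P.Is2ERF mult) {v : P.Vred} (hb : v ≠ ⊥)
    (hv : ∀ e ∈ P.mSupport mult, ∀ w, P.endsRed e = s(v, w) → v = w) (hI : v ∉ P.isoSet) :
    ∃ mult' : P.Ered → ℕ, P.Is2ERF mult' ∧ (∀ e, mult e ≤ mult' e) ∧ mult ≠ mult' := by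
  obtain ⟨hac, hle, hC1, hC3⟩ := hm
  obtain ⟨e, w, hew, hvw⟩ : ∃ e w, P.endsRed e = s(v, w) ∧ v ≠ w := by
    by_contra hcon
    push Not at hcon
    exact hI (P.mem_isoSet.2 ⟨hb, hcon⟩)
  have heF : e ∉ P.mSupport mult := fun h => hvw (hv e h w hew)
  have he0 : mult e = 0 := by
    by_contra h; exact heF (P.mem_mSupport.2 h)
  have hnr : ¬ Reachable P.endsRed (P.mSupport mult) w v :=
    fun h => hvw (P.eq_of_reach hv h.symm).symm
  have hwv : P.endsRed e = s(w, v) := by rw [hew, Sym2.eq_swap]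
  have hc0 : P.compCount mult v = 0 := P.count_zero hac hb hv
  have hsup := P.support_add (mult := mult) (e := e)
  have hnear : ∀ x, Reachable P.endsRed (insert e (P.mSupport mult)) x w →
      P.compCount (Function.update mult e 1) x = P.compCount mult w := by
    intro x hx
    rw [P.count_add_near he0 hwv hnr hx, hc0, add_zero]
  have hsub : P.mSupport mult ⊆ insert e (P.mSupport mult) := Finset.subset_insert _ _
  have hev : Reachable P.endsRed (insert e (P.mSupport mult)) w v := Reachable.edge (by simp) hwv
  have hfar : ∀ x, ¬ Reachable P.endsRed (insert e (P.mSupport mult)) x w →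
      P.compCount (Function.update mult e 1) x = P.compCount mult x := by
    intro x hx
    exact P.count_add_far he0 hwv (fun h => hx (h.mono hsub))
      (fun h => hx ((h.mono hsub).trans hev.symm))
  -- each component has a representative with the old count
  have hrepr : ∀ x, ∃ y, Reachable P.endsRed (insert e (P.mSupport mult)) x y ∧
      P.compCount (Function.update mult e 1) x = P.compCount mult y ∧
      (Reachable P.endsRed (insert e (P.mSupport mult)) y ⊥ →
        Reachable P.endsRed (P.mSupport mult) y ⊥) := by
    intro x
    by_cases hx : Reachable P.endsRed (insert e (P.mSupport mult)) x w
    · refine ⟨w, hx, hnear x hx, ?_⟩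
      intro h
      rw [P.reach_add hwv] at h
      rcases h with h | ⟨_, h⟩ | ⟨h, _⟩
      · exact h
      · exact absurd (P.eq_of_reach hv h).symm hb
      · exact absurd h hnr
    · refine ⟨x, Reachable.refl _ _, hfar x hx, ?_⟩
      intro h
      rw [P.reach_add hwv] at h
      rcases h with h | ⟨h, _⟩ | ⟨h, _⟩
      · exact h
      · exact absurd (h.mono hsub) hx
      · exact absurd ((h.mono hsub).trans hev.symm) hx
  refine ⟨Function.update mult e 1, ⟨?_, ?_, ?_, ?_⟩, ?_, ?_⟩
  · rw [hsup]; exact hac.insert hwv hnr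
  · intro x
    obtain ⟨y, _, h, _⟩ := hrepr x
    rw [h]; exact hle y
  · intro x z hx hz
    obtain ⟨y, h1, h2, _⟩ := hrepr x
    obtain ⟨y', h1', h2', _⟩ := hrepr z
    rw [hsup]
    exact h1.trans (((hC1 y y' (h2 ▸ hx) (h2' ▸ hz)).mono hsub).trans h1'.symm)
  · intro x hx
    obtain ⟨y, h1, h2, h3⟩ := hrepr x
    refine P.C3_mono (mult := mult) (y := y) ?_ ?_ ?_ ?_ ?_
    · intro f hf
      have : f ≠ e := by rintro rfl; omega
      rw [Function.update_of_ne this]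
    · rw [hsup]; exact hsub
    · rw [hsup]; exact h1
    · rw [hsup]; exact h3
    · exact hC3 y (h2 ▸ hx)
  · intro f
    by_cases hf : f = e
    · subst hf; simp [he0]
    · simp [hf]
  · intro h
    have := congrFun h e
    simp [he0] at this

lemma le_raise (mult : P.Ered → ℕ) (e : P.Ered) :
    (∀ f, mult f ≤ Function.update mult e (mult e + 1) f) ∧
      mult ≠ Function.update mult e (mult e + 1) := by
  constructor
  · intro f
    by_cases hf : f = e
    · subst hf; simp
    · simp [hf]
  · intro h
    have := congrFun h e
    simp at this

lemma ext_unrooted {mult : P.Ered → ℕ} (hm : P.Is2ERF mult) {v : P.Vred}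
    (hc : P.compCount mult v = 0) {e : P.Ered} (he : e ∈ P.mSupport mult) {w : P.Vred}
    (hvw : P.endsRed e = s(v, w)) :
    ∃ mult' : P.Ered → ℕ, P.Is2ERF mult' ∧ (∀ e, mult e ≤ mult' e) ∧ mult ≠ mult' := by
  obtain ⟨hac, hle, hC1, hC3⟩ := hm
  have hsup := P.support_raise he
  have he1 : mult e = 1 := by
    have h0 : mult e ≠ 0 := P.mem_mSupport.1 he
    unfold compCount at hc
    have h1 : P.compEdgeRoots mult v = 0 := by omega
    unfold compEdgeRoots at h1
    have h2 := (Finset.sum_eq_zero_iff.1 h1) e he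
    rw [if_pos ((P.touches_iff he hvw v).2 (Reachable.refl _ _))] at h2
    omega
  have hcount := P.count_raise he
  have hcase : ∀ x, P.compCount (Function.update mult e (mult e + 1)) x = 1 ∨
      P.compCount (Function.update mult e (mult e + 1)) x = P.compCount mult x := by
    intro x
    rw [hcount x]
    by_cases ht : P.Touches (P.mSupport mult) x e
    · left
      rw [if_pos ht, P.compCount_congr ((P.touches_iff he hvw x).1 ht), hc]
    · right
      rw [if_neg ht, add_zero]
  refine ⟨Function.update mult e (mult e + 1), ⟨?_, ?_, ?_, ?_⟩, P.le_raise mult e⟩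
  · rw [hsup]; exact hac
  · intro x
    rcases hcase x with h | h
    · omega
    · rw [h]; exact hle x
  · intro x y hx hy
    rw [hsup]
    apply hC1
    · rcases hcase x with h | h <;> omega
    · rcases hcase y with h | h <;> omega
  · intro x hx
    refine P.C3_mono (mult := mult) (y := x) ?_ ?_ ?_ ?_ ?_
    · intro f hf
      have : f ≠ e := by rintro rfl; omega
      rw [Function.update_of_ne this]
    · rw [hsup]
    · exact Reachable.refl _ _
    · rw [hsup]; exact id
    · apply hC3
      rcases hcase x with h | h <;> omega

/-- Raising a suitable edge in a component with count one. -/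
lemma ext_raise {mult : P.Ered → ℕ} (hm : P.Is2ERF mult)
    (h2 : ∀ x, P.compCount mult x ≠ 2) {u : P.Vred} (hu : P.compCount mult u = 1)
    {e : P.Ered} (he : e ∈ P.mSupport mult) (ht : P.Touches (P.mSupport mult) u e)
    (hC : P.C3At (Function.update mult e (mult e + 1)) u) :
    ∃ mult' : P.Ered → ℕ, P.Is2ERF mult' ∧ (∀ e, mult e ≤ mult' e) ∧ mult ≠ mult' := by
  obtain ⟨hac, hle, hC1, hC3⟩ := hm
  have hsup := P.support_raise he
  have hcount := P.count_raise he
  have hto : ∀ x, P.Touches (P.mSupport mult) x e → Reachable P.endsRed (P.mSupport mult) x u := by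
    intro x hx
    obtain ⟨a, b, hab⟩ := exists_ends P.endsRed e
    rw [P.touches_iff he hab] at ht hx
    exact hx.trans ht.symm
  have hcase : ∀ x, P.compCount (Function.update mult e (mult e + 1)) x ≤ 2 ∧
      (P.compCount (Function.update mult e (mult e + 1)) x = 2 →
        Reachable P.endsRed (P.mSupport mult) x u) := by
    intro x
    rw [hcount x]
    by_cases hx : P.Touches (P.mSupport mult) x e
    · rw [if_pos hx, P.compCount_congr (hto x hx), hu]
      exact ⟨le_refl _, fun _ => hto x hx⟩
    · rw [if_neg hx, add_zero]
      exact ⟨hle x, fun h => absurd h (h2 x)⟩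
  refine ⟨Function.update mult e (mult e + 1), ⟨?_, ?_, ?_, ?_⟩, P.le_raise mult e⟩
  · rw [hsup]; exact hac
  · exact fun x => (hcase x).1
  · intro x y hx hy
    rw [hsup]
    exact ((hcase x).2 hx).trans ((hcase y).2 hy).symm
  · intro x hx
    refine P.C3_mono (mult := Function.update mult e (mult e + 1)) (y := u) ?_ ?_ ?_ ?_ ?_
    · intro f _; rfl
    · exact Finset.Subset.refl _
    · rw [hsup]; exact (hcase x).2 hx
    · exact id
    · exact hC

lemma getLast_edge {ε ν : Type} {ends : ε → Sym2 ν} {u v : ν} (p : MWalk ends u v) (h : u ≠ v) :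
    ∃ e, p.edges.getLast? = some e := by
  cases p with
  | nil => exact absurd rfl h
  | cons e w h p =>
    exact ⟨_, List.getLast?_eq_some_getLast (by simp [MWalk.edges])⟩

lemma mem_of_getLast {α : Type} {l : List α} {a : α} (h : l.getLast? = some a) : a ∈ l :=
  List.mem_of_getLast? h

/-- last edge of a walk in F is touched by the endpoints -/
lemma touches_walk {F : Finset P.Ered} {u v : P.Vred} (p : MWalk P.endsRed u v)
    (hp : p.edgesIn F) {e : P.Ered} (he : e ∈ p.edges) : P.Touches F u e := by
  induction p with
  | nil => simp [MWalk.edges] at he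
  | @cons u w f x h p ih =>
    simp only [MWalk.edges, List.mem_cons] at he
    rcases he with rfl | he
    · exact ⟨u, by rw [h]; simp, Reachable.refl _ _⟩
    · have := ih (fun f hf => hp f (by simp [MWalk.edges, hf])) he
      exact (P.touches_congr (Reachable.edge (hp f (by simp [MWalk.edges])) h) e).2 this

lemma ext_bridge_in {mult : P.Ered → ℕ} (hm : P.Is2ERF mult)
    (h2 : ∀ x, P.compCount mult x ≠ 2) {u v : P.Vred} (hu : P.compCount mult u = 1)
    {e : P.Ered} (he : e ∈ P.mSupport mult) (huv : P.endsRed e = s(u, v))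
    (hs : P.side u ≠ P.side v) :
    ∃ mult' : P.Ered → ℕ, P.Is2ERF mult' ∧ (∀ e, mult e ≤ mult' e) ∧ mult ≠ mult' := by
  have hac := hm.1
  have hruv : Reachable P.endsRed (P.mSupport mult) u v := Reachable.edge he huv
  -- every side is represented in the component
  have hz : ∀ b : Bool, ∃ z, Reachable P.endsRed (P.mSupport mult) u z ∧ P.side z ≠ b := by
    intro b
    by_cases h : P.side u = b
    · exact ⟨v, hruv, fun h' => hs (h.trans h'.symm)⟩
    · exact ⟨u, Reachable.refl _ _, h⟩
  by_cases hb : Reachable P.endsRed (P.mSupport mult) u ⊥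
  · obtain ⟨z, hz1, hz2⟩ := hz (P.side ⊥)
    obtain ⟨p0, hp0⟩ := hb.symm.trans hz1
    obtain ⟨p, hp, hpF⟩ := p0.exists_path _ hp0
    have hne : (⊥ : P.Vred) ≠ z := by rintro rfl; exact hz2 rfl
    obtain ⟨f, hf⟩ := getLast_edge p hne
    have hfm := mem_of_getLast hf
    have hfF := hpF f hfm
    apply P.ext_raise hm h2 hu hfF ((P.touches_congr hb f).2 (P.touches_walk p hpF hfm))
    refine ⟨fun _ => ⟨z, p, hp, ?_, ⟨f, hf, ?_⟩, ?_⟩, fun h => ?_⟩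
    · rwa [P.support_raise hfF]
    · have := P.mem_mSupport.1 hfF
      simp only [Function.update_self]; omega
    · exact (p.odd_bridge P.side).2 hz2.symm
    · rw [P.support_raise hfF] at h; exact absurd hb h
  · obtain ⟨r, hr, hrt, hr2⟩ := P.exists_root hu hb
    obtain ⟨x, y, hxy⟩ := exists_ends P.endsRed r
    have hux := (P.touches_iff hr hxy u).1 hrt
    have hne := P.acyclic_ne hac hr hxy
    -- a path with first edge r and odd count
    obtain ⟨a, z, p, hp, hpF, hua, hhead, hodd⟩ : ∃ (a z : P.Vred) (p : MWalk P.endsRed a z),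
        p.IsPath ∧ p.edgesIn (P.mSupport mult) ∧ Reachable P.endsRed (P.mSupport mult) u a ∧
        p.edges.head? = some r ∧ P.side a ≠ P.side z := by
      by_cases hside : P.side x = P.side y
      · obtain ⟨z, hz1, hz2⟩ := hz (P.side x)
        obtain ⟨a, p, ha, hp, hpF, hh⟩ := exists_path_head hr hxy hne (hux.symm.trans hz1)
        refine ⟨a, z, p, hp, hpF, hz1.trans (p.reach_of_mem hpF p.start_mem).symm, hh, ?_⟩
        rcases ha with rfl | rfl
        · exact hz2.symm
        · rw [← hside]; exact hz2.symm
      · refine ⟨x, y, MWalk.cons r y hxy (MWalk.nil y), ?_, ?_, hux, rfl, hside⟩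
        · simp [MWalk.IsPath, MWalk.support, hne]
        · intro f hf
          simp only [MWalk.edges, List.mem_singleton] at hf
          rwa [hf]
    have haz : a ≠ z := by rintro rfl; exact hodd rfl
    obtain ⟨f, hf⟩ := getLast_edge p haz
    have hfm := mem_of_getLast hf
    have hfF := hpF f hfm
    apply P.ext_raise hm h2 hu hfF ((P.touches_congr hua f).2 (P.touches_walk p hpF hfm))
    refine ⟨fun h => ?_, fun _ => ⟨a, z, p, hp, ?_, ?_, ⟨r, hhead, ?_⟩, ⟨f, hf, ?_⟩, ?_, ?_⟩⟩
    · rw [P.support_raise hfF] at h; exact absurd h hb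
    · rwa [P.support_raise hfF]
    · rwa [P.support_raise hfF]
    · exact hr2.ge.trans ((P.le_raise mult f).1 r)
    · have := P.mem_mSupport.1 hfF
      simp only [Function.update_self]; omega
    · intro g hg
      rw [hg] at hhead hf
      simp only [List.head?_cons, Option.some.injEq, List.getLast?_singleton] at hhead hf
      subst hhead
      subst hf
      simp [hr2]
    · exact (p.odd_bridge P.side).2 hodd

lemma path_join {F : Finset P.Ered} {e : P.Ered} {a u v b : P.Vred}
    (huv : P.endsRed e = s(u, v)) (hnr : ¬ Reachable P.endsRed F u v)
    (p : MWalk P.endsRed a u) (q : MWalk P.endsRed v b)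
    (hp : p.IsPath) (hpF : p.edgesIn F) (hq : q.IsPath) (hqF : q.edgesIn F) :
    (p.append (MWalk.cons e v huv q)).IsPath ∧
      (p.append (MWalk.cons e v huv q)).edgesIn (insert e F) := by
  constructor
  · unfold MWalk.IsPath
    rw [MWalk.support_append_cons, List.nodup_append']
    refine ⟨hp, hq, ?_⟩
    intro x hx hx'
    have h1 := p.reach_of_mem hpF hx
    have h2 := q.reach_of_mem hqF hx'
    have h3 := q.reach_of_mem hqF q.start_mem
    exact hnr (h1.symm.trans (h2.trans h3.symm))
  · intro f hf
    rw [MWalk.edges_append, List.mem_append] at hf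
    simp only [MWalk.edges, List.mem_cons] at hf
    rw [Finset.mem_insert]
    rcases hf with hf | hf | hf
    · exact Or.inr (hpF f hf)
    · exact Or.inl hf
    · exact Or.inr (hqF f hf)

lemma exists_path_last {F : Finset P.Ered} {r : P.Ered} (hr : r ∈ F)
    (hac : IsAcyclic P.endsRed F) {v : P.Vred} (ht : P.Touches F v r) :
    ∃ (b : P.Vred) (q : MWalk P.endsRed v b), q.IsPath ∧ q.edgesIn F ∧
      q.edges.getLast? = some r := by
  obtain ⟨x, y, hxy⟩ := exists_ends P.endsRed r
  obtain ⟨a, p, _, hp, hpF, hh⟩ := exists_path_head hr hxy (P.acyclic_ne hac hr hxy)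
    ((P.touches_iff hr hxy v).1 ht).symm
  refine ⟨a, p.reverse, hp.reverse, hpF.reverse, ?_⟩
  rw [MWalk.edges_reverse, List.getLast?_reverse, hh]

/-- (C3) after joining, when `⊥` is on the side of `u`. -/
lemma join_bot {mult : P.Ered → ℕ} (hac : IsAcyclic P.endsRed (P.mSupport mult))
    {u v : P.Vred} {e : P.Ered} (huv : P.endsRed e = s(u, v)) (he : mult e = 0)
    (hnr : ¬ Reachable P.endsRed (P.mSupport mult) u v) (hv : P.compCount mult v = 1)
    (hmono : ∀ x y, Reachable P.endsRed (P.mSupport mult) x y → P.side x = P.side y)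
    (hs : P.side u ≠ P.side v) (hb : Reachable P.endsRed (P.mSupport mult) u ⊥) :
    ∃ (x : P.Vred) (p : MWalk P.endsRed (⊥ : P.Vred) x),
      p.IsPath ∧ p.edgesIn (insert e (P.mSupport mult)) ∧
      (∃ f, p.edges.getLast? = some f ∧ 2 ≤ Function.update mult e 1 f) ∧
      Odd (p.bridgeCount P.side) := by
  obtain ⟨r, hr, hrt, hr2⟩ := P.exists_root hv (fun h => hnr (hb.trans h.symm))
  obtain ⟨b, q, hq, hqF, hql⟩ := P.exists_path_last hr hac hrt
  obtain ⟨p0, hp0⟩ := hb.symm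
  obtain ⟨p, hp, hpF⟩ := p0.exists_path _ hp0
  obtain ⟨h1, h2⟩ := P.path_join huv hnr p q hp hpF hq hqF
  refine ⟨b, _, h1, h2, ⟨r, ?_, ?_⟩, ?_⟩
  · rw [MWalk.edges_append, MWalk.edges, List.getLast?_append, List.getLast?_cons, hql]; simp
  · have : r ≠ e := by rintro rfl; omega
    rw [Function.update_of_ne this, hr2]
  · rw [MWalk.odd_bridge, ← hmono _ _ hb, ← hmono v b ⟨q, hqF⟩]
    exact hs

lemma ext_bridge_out {mult : P.Ered → ℕ} (hm : P.Is2ERF mult)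
    (h2 : ∀ x, P.compCount mult x ≠ 2) {u v : P.Vred} (hu : P.compCount mult u = 1)
    (hv : P.compCount mult v = 1)
    (hmono : ∀ x y, Reachable P.endsRed (P.mSupport mult) x y → P.side x = P.side y)
    {e : P.Ered} (huv : P.endsRed e = s(u, v)) (hs : P.side u ≠ P.side v) :
    ∃ mult' : P.Ered → ℕ, P.Is2ERF mult' ∧ (∀ e, mult e ≤ mult' e) ∧ mult ≠ mult' := by
  obtain ⟨hac, hle, hC1, hC3⟩ := hm
  have hnr : ¬ Reachable P.endsRed (P.mSupport mult) u v := fun h => hs (hmono _ _ h)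
  have he0 : mult e = 0 := by
    by_contra h
    exact hnr (Reachable.edge (P.mem_mSupport.2 h) huv)
  have hvu : P.endsRed e = s(v, u) := by rw [huv, Sym2.eq_swap]
  have hsup := P.support_add (mult := mult) (e := e)
  have hsub : P.mSupport mult ⊆ insert e (P.mSupport mult) := Finset.subset_insert _ _
  have hev : Reachable P.endsRed (insert e (P.mSupport mult)) u v := Reachable.edge (by simp) huv
  have hcase : ∀ x, P.compCount (Function.update mult e 1) x ≤ 2 ∧
      (P.compCount (Function.update mult e 1) x = 2 →
        Reachable P.endsRed (insert e (P.mSupport mult)) x u) := by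
    intro x
    by_cases hx : Reachable P.endsRed (insert e (P.mSupport mult)) x u
    · rw [P.count_add_near he0 huv hnr hx, hu, hv]
      exact ⟨le_refl _, fun _ => hx⟩
    · rw [P.count_add_far he0 huv (fun h => hx (h.mono hsub))
        (fun h => hx ((h.mono hsub).trans hev.symm))]
      exact ⟨hle x, fun h => absurd h (h2 x)⟩
  refine ⟨Function.update mult e 1, ⟨?_, fun x => (hcase x).1, ?_, ?_⟩, ?_, ?_⟩
  · rw [hsup]; exact hac.insert huv hnr
  · intro x y hx hy
    rw [hsup]
    exact ((hcase x).2 hx).trans ((hcase y).2 hy).symm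
  · intro x hx
    have hxu := (hcase x).2 hx
    unfold C3At
    rw [hsup]
    constructor
    · intro hxb
      have hub := hxu.symm.trans hxb
      rw [P.reach_add huv] at hub
      rcases hub with h | ⟨_, h⟩ | ⟨_, h⟩
      · exact P.join_bot hac huv he0 hnr hv hmono hs h
      · exact P.join_bot hac hvu he0 (fun h => hnr h.symm) hu hmono hs.symm h
      · exact P.join_bot hac huv he0 hnr hv hmono hs h
    · intro hxb
      have hub : ¬ Reachable P.endsRed (P.mSupport mult) u ⊥ :=
        fun h => hxb (hxu.trans (h.mono hsub))
      have hvb : ¬ Reachable P.endsRed (P.mSupport mult) v ⊥ :=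
        fun h => hxb (hxu.trans (hev.trans (h.mono hsub)))
      obtain ⟨r, hr, hrt, hr2⟩ := P.exists_root hu hub
      obtain ⟨r', hr', hrt', hr2'⟩ := P.exists_root hv hvb
      obtain ⟨a, p, hp, hpF, hpl⟩ := P.exists_path_last hr hac hrt
      obtain ⟨b, q, hq, hqF, hql⟩ := P.exists_path_last hr' hac hrt'
      obtain ⟨h1, h2⟩ := P.path_join huv hnr p.reverse q hp.reverse hpF.reverse hq hqF
      have hre : r ≠ e := by rintro rfl; omega
      have hre' : r' ≠ e := by rintro rfl; omega
      have hhead : (p.reverse.append (MWalk.cons e v huv q)).edges.head? = some r := by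
        rw [MWalk.edges_append, MWalk.edges_reverse, List.head?_append, List.head?_reverse, hpl]
        simp
      refine ⟨a, b, _, h1, h2, ?_, ⟨r, hhead, ?_⟩, ⟨r', ?_, ?_⟩, ?_, ?_⟩
      · exact hxu.trans (Reachable.mono ⟨p, hpF⟩ hsub)
      · rw [Function.update_of_ne hre, hr2]
      · rw [MWalk.edges_append, MWalk.edges, List.getLast?_append, List.getLast?_cons, hql]; simp
      · rw [Function.update_of_ne hre', hr2']
      · intro f hf
        exfalso
        have hemem : e ∈ (p.reverse.append (MWalk.cons e v huv q)).edges := by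
          rw [MWalk.edges_append]; simp [MWalk.edges]
        rw [hf] at hhead hemem
        simp only [List.head?_cons, Option.some.injEq, List.mem_singleton] at hhead hemem
        exact hre (hhead.symm.trans hemem.symm)
      · rw [MWalk.odd_bridge, ← hmono u a ⟨p, hpF⟩, ← hmono v b ⟨q, hqF⟩]
        exact hs
  · intro f
    by_cases hf : f = e
    · subst hf; simp [he0]
    · simp [hf]
  · intro h
    have := congrFun h e
    simp [he0] at this

/-- A 2-edge-rooted component forces a bridging edge. -/
lemma exists_bridging {mult : P.Ered → ℕ} (hm : P.Is2ERF mult) {x : P.Vred}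
    (hx : P.compCount mult x = 2) :
    ∃ e u v, P.endsRed e = s(u, v) ∧ P.side u ≠ P.side v := by
  by_contra hcon
  push Not at hcon
  have key : ∀ {a b : P.Vred} (p : MWalk P.endsRed a b), ¬ Odd (p.bridgeCount P.side) := by
    intro a b p h
    rw [MWalk.odd_bridge] at h
    exact h (p.bridge_side P.side Finset.univ (fun e _ => Finset.mem_univ e)
      (fun e _ a b hab => hcon e a b hab))
  have h3 := hm.2.2.2 x hx
  by_cases hb : Reachable P.endsRed (P.mSupport mult) x ⊥
  · obtain ⟨_, p, _, _, _, h⟩ := h3.1 hb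
    exact key p h
  · obtain ⟨_, _, p, _, _, _, _, _, _, h⟩ := h3.2 hb
    exact key p h

end BiconedGraph

/-- Lemma 4.4, key step.  Every 2-edge-rooted forest of
`G^{A,B}_red` that is not of maximal degree is a proper sub-multiset of some
other 2-edge-rooted forest of `G^{A,B}_red`. -/
theorem not_maxDegree_exists_larger (P : BiconedGraph)
    (mult : P.Ered → ℕ) (hm : P.Is2ERF mult)
    (hnotmax : ∃ mult₁ : P.Ered → ℕ, P.Is2ERF mult₁ ∧ P.deg mult < P.deg mult₁) :
    ∃ mult' : P.Ered → ℕ, P.Is2ERF mult' ∧ (∀ e, mult e ≤ mult' e) ∧ mult ≠ mult' := by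
  by_contra hno
  obtain ⟨mult₁, hm₁, hlt⟩ := hnotmax
  -- every vertex outside the isolated set has positive count
  have hpos : ∀ v, v ∉ P.isoSet → 1 ≤ P.compCount mult v := by
    intro v hv
    by_contra hc
    have hc0 : P.compCount mult v = 0 := by omega
    have hb : v ≠ ⊥ := by
      rintro rfl
      unfold BiconedGraph.compCount at hc0
      rw [if_pos (Reachable.refl _ _)] at hc0
      omega
    by_cases hiso : ∀ e ∈ P.mSupport mult, ∀ w, P.endsRed e = s(v, w) → v = w
    · exact hno (P.ext_isolated hm hb hiso hv)
    · push Not at hiso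
      obtain ⟨e, he, w, hvw, _⟩ := hiso
      exact hno (P.ext_unrooted hm hc0 he hvw)
  -- a bridging edge forces a component with count two
  have htwo : (∃ e u v, P.endsRed e = s(u, v) ∧ P.side u ≠ P.side v) →
      ∃ x, P.compCount mult x = 2 := by
    rintro ⟨e, u, v, huv, hs⟩
    by_contra hcon
    push Not at hcon
    have hone : ∀ v, v ∉ P.isoSet → P.compCount mult v = 1 := by
      intro v hv
      have h1 := hpos v hv
      have h2 := hm.2.1 v
      have h3 := hcon v
      omega
    have hend : ∀ (f : P.Ered) (a b : P.Vred), P.endsRed f = s(a, b) → P.side a ≠ P.side b →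
        P.compCount mult a = 1 := by
      intro f a b hab hs
      apply hone
      intro h
      have := (P.mem_isoSet.1 h).2 f b hab
      subst this
      exact hs rfl
    by_cases hF : ∀ f ∈ P.mSupport mult, ∀ a b, P.endsRed f = s(a, b) → P.side a = P.side b
    · refine hno (P.ext_bridge_out hm hcon (hend e u v huv hs)
        (hend e v u (by rw [huv, Sym2.eq_swap]) hs.symm) ?_ huv hs)
      rintro x y ⟨p, hp⟩
      exact p.bridge_side P.side _ hp hF
    · push Not at hF
      obtain ⟨f, hf, a, b, hab, hs'⟩ := hF
      exact hno (P.ext_bridge_in hm hcon (hend f a b hab hs') hf hab hs')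
  obtain ⟨rep, h1, h2, h3⟩ := exists_rep (P.mSupport mult) hm.1
  obtain ⟨rep₁, g1, g2, g3⟩ := exists_rep (P.mSupport mult₁) hm₁.1
  have hd := P.deg_formula mult rep h1 h2 h3
  have gd := P.deg_formula mult₁ rep₁ g1 g2 g3
  have hsub : ∀ (mu : P.Ered → ℕ) (rp : P.Vred → P.Vred),
      (∀ u v, rp u = rp v ↔ Reachable P.endsRed (P.mSupport mu) u v) →
      (∀ v, rp (rp v) = rp v) → P.isoSet ⊆ Finset.univ.image rp := by
    intro mu rp k1 k2 v hv
    have : Reachable P.endsRed (P.mSupport mu) v (rp v) := (k1 _ _).1 (k2 v).symm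
    have := P.eq_of_reach (fun e _ w h => (P.mem_isoSet.1 hv).2 e w h) this
    exact Finset.mem_image.2 ⟨v, Finset.mem_univ _, this⟩
  have hzero : ∀ (mu : P.Ered → ℕ), P.Is2ERF mu → ∀ v ∈ P.isoSet, P.compCount mu v = 0 := by
    intro mu hmu v hv
    have := P.mem_isoSet.1 hv
    exact P.count_zero hmu.1 this.1 (fun e _ w h => this.2 e w h)
  have hsplit : ∀ (mu : P.Ered → ℕ), P.Is2ERF mu → ∀ R : Finset P.Vred, P.isoSet ⊆ R →
      ∑ r ∈ R, P.compCount mu r = ∑ r ∈ R \ P.isoSet, P.compCount mu r := by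
    intro mu hmu R hR
    rw [← Finset.sum_sdiff hR, Finset.sum_eq_zero (hzero mu hmu), add_zero]
  have hS := hsub mult rep h1 h2
  have gS := hsub mult₁ rep₁ g1 g2
  have hcard := Finset.card_sdiff_add_card_eq_card hS
  have gcard := Finset.card_sdiff_add_card_eq_card gS
  rw [hsplit mult hm _ hS] at hd
  rw [hsplit mult₁ hm₁ _ gS] at gd
  -- upper bound for mult₁
  have gupper : ∑ r ∈ Finset.univ.image rep₁ \ P.isoSet, P.compCount mult₁ r ≤
      (Finset.univ.image rep₁ \ P.isoSet).card +
      ((Finset.univ.image rep₁ \ P.isoSet).filter fun r => P.compCount mult₁ r = 2).card := by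
    rw [Finset.card_eq_sum_ones, Finset.card_filter, ← Finset.sum_add_distrib]
    apply Finset.sum_le_sum
    intro r _
    have := hm₁.2.1 r
    split_ifs <;> omega
  have gone : ((Finset.univ.image rep₁ \ P.isoSet).filter
      fun r => P.compCount mult₁ r = 2).card ≤ 1 := by
    rw [Finset.card_le_one]
    intro a ha b hb
    simp only [Finset.mem_filter, Finset.mem_sdiff, Finset.mem_image, Finset.mem_univ,
      true_and] at ha hb
    obtain ⟨⟨⟨a', rfl⟩, _⟩, ha2⟩ := ha
    obtain ⟨⟨⟨b', rfl⟩, _⟩, hb2⟩ := hb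
    have := (g1 _ _).2 (hm₁.2.2.1 _ _ ha2 hb2)
    rwa [g2, g2] at this
  -- lower bound for mult
  have hlower : (Finset.univ.image rep \ P.isoSet).card ≤
      ∑ r ∈ Finset.univ.image rep \ P.isoSet, P.compCount mult r := by
    rw [Finset.card_eq_sum_ones]
    apply Finset.sum_le_sum
    intro r hr
    exact hpos r (Finset.mem_sdiff.1 hr).2
  by_cases hex : ∃ x, P.compCount mult₁ x = 2
  · obtain ⟨x₁, hx₁⟩ := hex
    obtain ⟨x, hx⟩ := htwo (P.exists_bridging hm₁ hx₁)
    have hstrict : (Finset.univ.image rep \ P.isoSet).card <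
        ∑ r ∈ Finset.univ.image rep \ P.isoSet, P.compCount mult r := by
      rw [Finset.card_eq_sum_ones]
      have hxr : P.compCount mult (rep x) = 2 := by
        rw [← hx]
        exact P.compCount_congr ((h1 _ _).1 (h2 x))
      apply Finset.sum_lt_sum
      · intro r hr
        exact hpos r (Finset.mem_sdiff.1 hr).2
      · refine ⟨rep x, ?_, by omega⟩
        rw [Finset.mem_sdiff]
        refine ⟨Finset.mem_image.2 ⟨x, Finset.mem_univ _, rfl⟩, fun h => ?_⟩
        have := hzero mult hm _ h
        omega
    omega
  · push Not at hex
    have : ((Finset.univ.image rep₁ \ P.isoSet).filter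
        fun r => P.compCount mult₁ r = 2) = ∅ := by
      apply Finset.filter_eq_empty_iff.2
      intro r _
      exact hex r
    rw [this, Finset.card_empty] at gupper
    omega

end

end BiconedPaper
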